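/- (Proposition 2, feedback-aided transmission.) Let P̂ ∈ [0,1] and let N̂ ≥ K be an integer. Define the feasible set S = { N ∈ ℕ : K ≤ N ≤ N̂ and F_B(N) ≥ P̂ }. If N* ∈ S satisfies N* ≤ N for all N ∈ S (i.e., N* is the minimum of S), then N* minimizes the feedback-aided intercept probability over S: P^FT_int(N*) ≤ P^FT_int(N) for all N ∈ S. -/

import Mathlib

open Finset

/-- Decoding probability P(n_R, K) = ∏_{i=0}^{K−1} (1 − q^{−(n_R − i)}). -/
noncomputable def Pdec (q K nR : ℕ) : ℝ :=
  ∏ i ∈ Finset.range K, (1 - (q : ℝ) ^ (-((nR : ℤ) - (i : ℤ))))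

/-- CDF F_ε(n_T) = ∑_{n_R=K}^{n_T} C(n_T,n_R) (1−ε)^{n_R} ε^{n_T−n_R} P(n_R,K). -/
noncomputable def Fcdf (q K : ℕ) (ε : ℝ) (nT : ℕ) : ℝ :=
  ∑ nR ∈ Finset.Icc K nT,
    (nT.choose nR : ℝ) * (1 - ε) ^ nR * ε ^ (nT - nR) * Pdec q K nR

/-- PMF f_ε(n_T) = F_ε(n_T) − F_ε(n_T−1) for n_T > K, and f_ε(K) = F_ε(K). -/
noncomputable def fpmf (q K : ℕ) (ε : ℝ) (nT : ℕ) : ℝ :=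
  if nT = K then Fcdf q K ε K else Fcdf q K ε nT - Fcdf q K ε (nT - 1)

/-- Intercept probability of feedback-aided transmission. -/
noncomputable def PFT (q K : ℕ) (εB εE : ℝ) (N : ℕ) : ℝ :=
  (∑ nT ∈ Finset.Icc K N, fpmf q K εB nT * Fcdf q K εE nT)
    + Fcdf q K εE N * (1 - Fcdf q K εB N)

/-- Intercept probability of unaided transmission. -/
noncomputable def PUT (q K : ℕ) (εE : ℝ) (N : ℕ) : ℝ := Fcdf q K εE N

theorem Pdec_eq_zero {q K n : ℕ} (h : n < K) : Pdec q K n = 0 :=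
  Finset.prod_eq_zero (Finset.mem_range.2 h) (by simp)

theorem Pdec_factor_nonneg {q i n : ℕ} (hq : 1 ≤ q) (h : i ≤ n) :
    0 ≤ 1 - (q : ℝ) ^ (-((n : ℤ) - (i : ℤ))) :=
  sub_nonneg.2 (zpow_le_one_of_nonpos₀ (by exact_mod_cast hq) (by lia))

theorem Pdec_nonneg {q : ℕ} (hq : 1 ≤ q) (K n : ℕ) : 0 ≤ Pdec q K n := by
  rcases lt_or_ge n K with h | h
  · exact (Pdec_eq_zero h).ge
  · exact Finset.prod_nonneg fun i hi =>
      Pdec_factor_nonneg hq (by have := Finset.mem_range.1 hi; lia)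

theorem Pdec_le_one {q : ℕ} (hq : 1 ≤ q) (K n : ℕ) : Pdec q K n ≤ 1 := by
  rcases lt_or_ge n K with h | h
  · exact (Pdec_eq_zero h).trans_le zero_le_one
  · exact Finset.prod_le_one
      (fun i hi => Pdec_factor_nonneg hq (by have := Finset.mem_range.1 hi; lia))
      fun i _ => sub_le_self _ (by positivity)

theorem Pdec_le_succ {q : ℕ} (hq : 1 ≤ q) (K n : ℕ) : Pdec q K n ≤ Pdec q K (n + 1) := by
  rcases lt_or_ge n K with h | h
  · exact (Pdec_eq_zero h).trans_le (Pdec_nonneg hq K _)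
  · refine Finset.prod_le_prod
      (fun i hi => Pdec_factor_nonneg hq (by have := Finset.mem_range.1 hi; lia)) fun i _ => ?_
    exact sub_le_sub_left
      (zpow_le_zpow_right₀ (by exact_mod_cast hq) (by push_cast; lia)) _

theorem Fcdf_eq_sum_antidiagonal (q K : ℕ) (ε : ℝ) (n : ℕ) :
    Fcdf q K ε n = ∑ ij ∈ Finset.HasAntidiagonal.antidiagonal n,
      (n.choose ij.1 : ℝ) * ((1 - ε) ^ ij.1 * ε ^ ij.2 * Pdec q K ij.1) := by
  rw [Finset.Nat.sum_antidiagonal_eq_sum_range_succ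
    (fun i j => (n.choose i : ℝ) * ((1 - ε) ^ i * ε ^ j * Pdec q K i)), Fcdf]
  simp only [mul_assoc]
  refine Finset.sum_subset (fun i hi => ?_) fun i hi hi' => ?_
  · simp only [Finset.mem_Icc, Finset.mem_range] at hi ⊢
    lia
  · simp only [Finset.mem_Icc, Finset.mem_range] at hi hi'
    simp [Pdec_eq_zero (q := q) (show i < K by lia)]

theorem Fcdf_le_one {q : ℕ} (hq : 1 ≤ q) (K : ℕ) {ε : ℝ} (hε : ε ∈ Set.Icc (0 : ℝ) 1) (n : ℕ) :
    Fcdf q K ε n ≤ 1 := by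
  have h1 : 0 ≤ 1 - ε := sub_nonneg.2 hε.2
  have h0 := hε.1
  have hsum : ∑ ij ∈ Finset.HasAntidiagonal.antidiagonal n,
      (n.choose ij.1 : ℝ) * ((1 - ε) ^ ij.1 * ε ^ ij.2) = 1 := by
    have := (Commute.all (1 - ε) ε).add_pow' n
    simpa using this.symm
  rw [Fcdf_eq_sum_antidiagonal]
  refine le_trans (Finset.sum_le_sum fun ij _ => ?_) hsum.le
  exact mul_le_mul_of_nonneg_left
    (mul_le_of_le_one_right (by positivity) (Pdec_le_one hq K _)) (by positivity)

theorem Fcdf_monotone {q : ℕ} (hq : 1 ≤ q) (K : ℕ) {ε : ℝ} (hε : ε ∈ Set.Icc (0 : ℝ) 1) :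
    Monotone (Fcdf q K ε) := by
  have h1 : 0 ≤ 1 - ε := sub_nonneg.2 hε.2
  have h0 := hε.1
  refine monotone_nat_of_le_succ fun n => ?_
  rw [Fcdf_eq_sum_antidiagonal, Fcdf_eq_sum_antidiagonal,
    Finset.sum_antidiagonal_choose_succ_mul
      (fun i j => (1 - ε) ^ i * ε ^ j * Pdec q K i), ← Finset.sum_add_distrib]
  refine Finset.sum_le_sum fun ij hij => ?_
  rw [← Nat.choose_symm_of_eq_add (Finset.HasAntidiagonal.mem_antidiagonal.1 hij).symm]
  have hP := mul_le_mul_of_nonneg_left (Pdec_le_succ hq K ij.1)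
    (show 0 ≤ (n.choose ij.1 : ℝ) * ((1 - ε) ^ (ij.1 + 1) * ε ^ ij.2) by positivity)
  linear_combination hP

theorem PFT_succ {q K N : ℕ} (hN : K ≤ N) (εB εE : ℝ) :
    PFT q K εB εE (N + 1) = PFT q K εB εE N +
      (Fcdf q K εE (N + 1) - Fcdf q K εE N) * (1 - Fcdf q K εB N) := by
  rw [PFT, PFT, Finset.sum_Icc_succ_top (by lia), fpmf, if_neg (by lia), Nat.add_sub_cancel]
  ring

theorem PFT_monotoneOn {q : ℕ} (hq : 1 ≤ q) (K : ℕ) {εB εE : ℝ}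
    (hεB : εB ∈ Set.Icc (0 : ℝ) 1) (hεE : εE ∈ Set.Icc (0 : ℝ) 1) :
    MonotoneOn (PFT q K εB εE) (Set.Ici K) := by
  intro M hM N _ hMN
  induction N, hMN using Nat.le_induction with
  | base => exact le_rfl
  | succ N hMN ih =>
    have hKN : K ≤ N := le_trans hM hMN
    rw [PFT_succ hKN]
    exact (ih hKN).trans (le_add_of_nonneg_right (mul_nonneg
      (sub_nonneg.2 (Fcdf_monotone hq K hεE N.le_succ)) (sub_nonneg.2 (Fcdf_le_one hq K hεB N))))

theorem ram_optimal_ft (q K : ℕ) (hq : 2 ≤ q) (hK : 1 ≤ K)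
    (εB εE : ℝ) (hεB : εB ∈ Set.Icc (0:ℝ) 1) (hεE : εE ∈ Set.Icc (0:ℝ) 1)
    (Phat : ℝ) (hPhat : Phat ∈ Set.Icc (0:ℝ) 1) (Nhat : ℕ) (hNhat : K ≤ Nhat)
    (Nstar : ℕ)
    (hmem : K ≤ Nstar ∧ Nstar ≤ Nhat ∧ Phat ≤ Fcdf q K εB Nstar)
    (hmin : ∀ N : ℕ, K ≤ N → N ≤ Nhat → Phat ≤ Fcdf q K εB N → Nstar ≤ N) :
    ∀ N : ℕ, K ≤ N → N ≤ Nhat → Phat ≤ Fcdf q K εB N →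
      PFT q K εB εE Nstar ≤ PFT q K εB εE N := by
  intro N hKN hN hP
  exact PFT_monotoneOn (by lia) K hεB hεE hmem.1 hKN (hmin N hKN hN hP)
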